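/- For every integer k ≥ 1 the following identities hold in ℚ[[q]]: [k; 1] = [k]·[1] − Σ_{a+b=k+1, a,b ≥ 1} [a,b] − [k,1] + [k], and [k; 1] = [k+1] + (1/2)·[k] − Σ_{a+b=k+1, a ≥ 2, b ≥ 1} [a,b] + Σ_{j=2}^{k−1} (B_{k−j+1}/(k−j+1)!) · [j] − (1/2)·δ_{k,1}·[1], where δ_{k,1} equals 1 if k=1 and 0 otherwise. -/

import Mathlib

open scoped Nat

/-- The bi-bracket `[s₁,…,sₗ; r₁,…,rₗ]`: the formal power series in `ℚ[[q]]` whose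
coefficient of `qⁿ` is the sum of `∏ⱼ (uⱼ^{rⱼ}/rⱼ!)·(vⱼ^{sⱼ−1}/(sⱼ−1)!)` over all
tuples `u₁ > … > uₗ > 0`, `v₁,…,vₗ > 0` with `u₁v₁ + … + uₗvₗ = n`. -/
noncomputable def biBracket (l : ℕ) (s r : Fin l → ℕ) : PowerSeries ℚ :=
  PowerSeries.mk fun n =>
    ∑ᶠ uv ∈ {uv : (Fin l → ℕ) × (Fin l → ℕ) |
        StrictAnti uv.1 ∧ (∀ j, 0 < uv.1 j) ∧ (∀ j, 0 < uv.2 j) ∧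
        (∑ j, uv.1 j * uv.2 j) = n},
      ∏ j, ((uv.1 j : ℚ) ^ r j / (r j)!) * ((uv.2 j : ℚ) ^ (s j - 1) / ((s j - 1)!))

open Finset

/-- The `(u₁, v₁), (u₂, v₂)` with positive entries and `u₁v₁ + u₂v₂ = n`. -/
def divisorQuadruples (n : ℕ) : Finset ((ℕ × ℕ) × (ℕ × ℕ)) :=
  {x ∈ (Icc 1 n ×ˢ Icc 1 n) ×ˢ (Icc 1 n ×ˢ Icc 1 n) | x.1.1 * x.1.2 + x.2.1 * x.2.2 = n}

theorem mem_divisorQuadruples {n u₁ v₁ u₂ v₂ : ℕ} :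
    ((u₁, v₁), (u₂, v₂)) ∈ divisorQuadruples n ↔
      0 < u₁ ∧ 0 < v₁ ∧ 0 < u₂ ∧ 0 < v₂ ∧ u₁ * v₁ + u₂ * v₂ = n := by
  simp only [divisorQuadruples, mem_filter, mem_product, mem_Icc]
  constructor
  · grind
  · rintro ⟨h₁, h₂, h₃, h₄, rfl⟩
    have := Nat.le_mul_of_pos_right u₁ h₂
    have := Nat.le_mul_of_pos_left v₁ h₁
    have := Nat.le_mul_of_pos_right u₂ h₄
    have := Nat.le_mul_of_pos_left v₂ h₃
    refine ⟨⟨⟨⟨?_, ?_⟩, ?_, ?_⟩, ⟨?_, ?_⟩, ?_, ?_⟩, rfl⟩ <;> omega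

theorem coeff_biBracket_one (n s r : ℕ) :
    PowerSeries.coeff n (biBracket 1 ![s] ![r]) =
      ∑ p ∈ n.divisorsAntidiagonal,
        ((p.1 : ℚ) ^ r / r !) * ((p.2 : ℚ) ^ (s - 1) / (s - 1)!) := by
  rw [biBracket, PowerSeries.coeff_mk, ← finsum_mem_coe_finset]
  refine finsum_mem_eq_of_bijOn (fun uv => (uv.1 0, uv.2 0)) ⟨?_, ?_, ?_⟩ ?_
  · rintro ⟨u, v⟩ ⟨-, hu, hv, h⟩
    have hu := hu 0
    have hv := hv 0
    simp at h hu hv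
    simp [h]
    rintro rfl
    grind [Nat.mul_eq_zero]
  · rintro ⟨u, v⟩ - ⟨u', v'⟩ - h
    simp only [Prod.mk.injEq] at h ⊢
    refine ⟨?_, ?_⟩ <;> ext i <;> fin_cases i <;> simp [h]
  · rintro ⟨u, v⟩ h
    simp at h
    obtain ⟨rfl, h⟩ := h
    refine ⟨(![u], ![v]), ⟨Subsingleton.strictAnti _, ?_, ?_, ?_⟩, by simp⟩ <;>
      simp <;> grind
  · rintro ⟨u, v⟩ -
    simp

theorem coeff_biBracket_two (n a b : ℕ) :
    PowerSeries.coeff n (biBracket 2 ![a, b] ![0, 0]) =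
      ∑ x ∈ divisorQuadruples n with x.2.1 < x.1.1,
        ((x.1.2 : ℚ) ^ (a - 1) / (a - 1)!) * ((x.2.2 : ℚ) ^ (b - 1) / (b - 1)!) := by
  rw [biBracket, PowerSeries.coeff_mk, ← finsum_mem_coe_finset]
  refine finsum_mem_eq_of_bijOn
    (fun uv => ((uv.1 0, uv.2 0), (uv.1 1, uv.2 1))) ⟨?_, ?_, ?_⟩ ?_
  · rintro ⟨u, v⟩ ⟨hanti, hu, hv, h⟩
    rw [Fin.sum_univ_two] at h
    simp only [coe_filter, Set.mem_ofPred_eq, mem_divisorQuadruples]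
    exact ⟨⟨hu 0, hv 0, hu 1, hv 1, h⟩, hanti (by decide)⟩
  · rintro ⟨u, v⟩ - ⟨u', v'⟩ - h
    simp only [Prod.mk.injEq] at h ⊢
    refine ⟨?_, ?_⟩ <;> ext i <;> fin_cases i <;> simp [h]
  · rintro ⟨⟨u₁, v₁⟩, ⟨u₂, v₂⟩⟩ h
    simp only [coe_filter, Set.mem_ofPred_eq, mem_divisorQuadruples] at h
    refine ⟨(![u₁, u₂], ![v₁, v₂]), ⟨?_, ?_, ?_, ?_⟩, by simp⟩
    · intro i j hij
      fin_cases i <;> fin_cases j <;> simp_all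
    · intro i
      fin_cases i <;> simp <;> omega
    · intro i
      fin_cases i <;> simp <;> omega
    · simpa using h.1.2.2.2.2
  · rintro ⟨u, v⟩ -
    simp [Fin.prod_univ_two]

theorem sum_antidiagonal_mul_sum_divisorsAntidiagonal (n : ℕ) (f g : ℕ × ℕ → ℚ) :
    ∑ p ∈ antidiagonal n,
        (∑ x ∈ p.1.divisorsAntidiagonal, f x) * ∑ y ∈ p.2.divisorsAntidiagonal, g y =
      ∑ x ∈ divisorQuadruples n, f x.1 * g x.2 := by
  simp_rw [sum_mul_sum, ← sum_product', sum_sigma']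
  refine sum_bij' (fun x _ => x.2) (fun x _ => ⟨(x.1.1 * x.1.2, x.2.1 * x.2.2), x⟩)
    ?_ ?_ ?_ ?_ ?_
  · rintro ⟨⟨i, j⟩, ⟨u₁, v₁⟩, ⟨u₂, v₂⟩⟩ h
    simp only [mem_sigma, HasAntidiagonal.mem_antidiagonal, mem_product, Nat.mem_divisorsAntidiagonal] at h
    obtain ⟨h, ⟨rfl, h₁⟩, rfl, h₂⟩ := h
    rw [mem_divisorQuadruples]
    simp only [ne_eq, Nat.mul_eq_zero, not_or] at h₁ h₂
    omega
  · rintro ⟨⟨u₁, v₁⟩, ⟨u₂, v₂⟩⟩ h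
    rw [mem_divisorQuadruples] at h
    simp only [mem_sigma, HasAntidiagonal.mem_antidiagonal, mem_product, Nat.mem_divisorsAntidiagonal, ne_eq,
      Nat.mul_eq_zero, not_or]
    exact ⟨h.2.2.2.2, ⟨trivial, by omega, by omega⟩, trivial, by omega, by omega⟩
  · rintro ⟨⟨i, j⟩, ⟨u₁, v₁⟩, ⟨u₂, v₂⟩⟩ h
    simp only [mem_sigma, HasAntidiagonal.mem_antidiagonal, mem_product, Nat.mem_divisorsAntidiagonal] at h
    obtain ⟨h, ⟨rfl, h₁⟩, rfl, h₂⟩ := h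
    rfl
  · intros; rfl
  · intros; rfl

theorem coeff_biBracket_mul_biBracket_one (n k : ℕ) :
    PowerSeries.coeff n (biBracket 1 ![k] ![0] * biBracket 1 ![1] ![0]) =
      ∑ x ∈ divisorQuadruples n, (x.1.2 : ℚ) ^ (k - 1) / (k - 1)! := by
  simp_rw [PowerSeries.coeff_mul, coeff_biBracket_one,
    sum_antidiagonal_mul_sum_divisorsAntidiagonal]
  simp

theorem sum_divisorQuadruples_fst_eq (n : ℕ) (f : ℕ → ℕ → ℚ) :
    ∑ x ∈ divisorQuadruples n with x.1.1 = x.2.1, f x.1.1 x.1.2 =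
      ∑ p ∈ n.divisorsAntidiagonal, ∑ m ∈ Ico 1 p.2, f p.1 m := by
  rw [sum_sigma']
  refine sum_bij' (fun x _ => ⟨(x.1.1, x.1.2 + x.2.2), x.1.2⟩)
    (fun y _ => ((y.1.1, y.2), (y.1.1, y.1.2 - y.2))) ?_ ?_ ?_ ?_ ?_
  · rintro ⟨⟨u₁, v₁⟩, ⟨u₂, v₂⟩⟩ h
    simp only [mem_filter, mem_divisorQuadruples] at h
    obtain ⟨⟨h₁, h₂, h₃, h₄, rfl⟩, rfl⟩ := h
    simp only [mem_sigma, Nat.mem_divisorsAntidiagonal, mem_Ico]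
    refine ⟨⟨by ring, by positivity⟩, by omega, by omega⟩
  · rintro ⟨⟨u, v⟩, m⟩ h
    simp only [mem_sigma, Nat.mem_divisorsAntidiagonal, mem_Ico] at h
    obtain ⟨⟨rfl, h⟩, hm, hmv⟩ := h
    obtain ⟨w, rfl⟩ := Nat.exists_eq_add_of_lt hmv
    simp only [ne_eq, Nat.mul_eq_zero, not_or] at h
    simp only [mem_filter, mem_divisorQuadruples, and_true]
    refine ⟨by omega, by omega, by omega, by omega, ?_⟩
    rw [← mul_add]
    congr 1
    omega
  · rintro ⟨⟨u₁, v₁⟩, ⟨u₂, v₂⟩⟩ h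
    simp only [mem_filter] at h
    simp [h.2]
  · rintro ⟨⟨u, v⟩, m⟩ h
    simp only [mem_sigma, mem_Ico] at h
    simp
    omega
  · intros; rfl

theorem sum_divisorQuadruples_transpose (n : ℕ) (p : (ℕ × ℕ) × (ℕ × ℕ) → Prop)
    [DecidablePred p] (f : (ℕ × ℕ) × (ℕ × ℕ) → ℚ) :
    ∑ x ∈ divisorQuadruples n with p x, f x =
      ∑ x ∈ divisorQuadruples n with p (x.1.swap, x.2.swap), f (x.1.swap, x.2.swap) := by
  refine sum_nbij' (fun x => (x.1.swap, x.2.swap)) (fun x => (x.1.swap, x.2.swap))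
    ?_ ?_ ?_ ?_ ?_ <;> rintro ⟨⟨u₁, v₁⟩, ⟨u₂, v₂⟩⟩ <;>
    simp +contextual [mem_divisorQuadruples, mul_comm]

theorem sum_divisorQuadruples_swap (n : ℕ) (p : (ℕ × ℕ) × (ℕ × ℕ) → Prop)
    [DecidablePred p] (f : (ℕ × ℕ) × (ℕ × ℕ) → ℚ) :
    ∑ x ∈ divisorQuadruples n with p x, f x =
      ∑ x ∈ divisorQuadruples n with p x.swap, f x.swap := by
  refine sum_nbij' Prod.swap Prod.swap ?_ ?_ ?_ ?_ ?_ <;> rintro ⟨⟨u₁, v₁⟩, ⟨u₂, v₂⟩⟩ <;>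
    simp +contextual [mem_divisorQuadruples, add_comm]

theorem sum_divisorQuadruples_snd_eq (n : ℕ) (f : ℕ → ℚ) :
    ∑ x ∈ divisorQuadruples n with x.1.2 = x.2.2, f x.1.2 =
      ∑ p ∈ n.divisorsAntidiagonal, ((p.1 : ℚ) - 1) * f p.2 := by
  rw [sum_divisorQuadruples_transpose]
  refine (sum_divisorQuadruples_fst_eq n fun u _ => f u).trans ?_
  refine sum_nbij' Prod.swap Prod.swap (by simp +contextual) (by simp +contextual)
    (by simp) (by simp) fun p hp => ?_
  have : 1 ≤ p.2 := Nat.pos_of_ne_zero (by rintro h; simp [h] at hp; omega)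
  simp [Nat.cast_sub this]

theorem sum_divisorQuadruples_snd_lt (n : ℕ) (f : ℕ → ℕ → ℚ) :
    ∑ x ∈ divisorQuadruples n with x.2.2 < x.1.2, f x.1.2 x.2.2 =
      ∑ x ∈ divisorQuadruples n with x.2.1 < x.1.1, f (x.1.2 + x.2.2) x.1.2 := by
  refine sum_nbij' (fun x => ((x.1.1 + x.2.1, x.2.2), (x.1.1, x.1.2 - x.2.2)))
    (fun x => ((x.2.1, x.1.2 + x.2.2), (x.1.1 - x.2.1, x.1.2))) ?_ ?_ ?_ ?_ ?_
  · rintro ⟨⟨u₁, v₁⟩, ⟨u₂, v₂⟩⟩ h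
    simp only [mem_filter, mem_divisorQuadruples] at h ⊢
    obtain ⟨⟨h₁, h₂, h₃, h₄, rfl⟩, h⟩ := h
    obtain ⟨w, rfl⟩ := Nat.exists_eq_add_of_lt h
    refine ⟨⟨by omega, by omega, by omega, by omega, ?_⟩, by omega⟩
    rw [show v₂ + w + 1 - v₂ = w + 1 by omega]
    ring
  · rintro ⟨⟨u₁, v₁⟩, ⟨u₂, v₂⟩⟩ h
    simp only [mem_filter, mem_divisorQuadruples] at h ⊢
    obtain ⟨⟨h₁, h₂, h₃, h₄, rfl⟩, h⟩ := h
    obtain ⟨w, rfl⟩ := Nat.exists_eq_add_of_lt h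
    refine ⟨⟨by omega, by omega, by omega, by omega, ?_⟩, by omega⟩
    rw [show u₂ + w + 1 - u₂ = w + 1 by omega]
    ring
  · rintro ⟨⟨u₁, v₁⟩, ⟨u₂, v₂⟩⟩ h
    simp only [mem_filter] at h
    simp
    omega
  · rintro ⟨⟨u₁, v₁⟩, ⟨u₂, v₂⟩⟩ h
    simp only [mem_filter] at h
    simp
    omega
  · rintro ⟨⟨u₁, v₁⟩, ⟨u₂, v₂⟩⟩ h
    simp only [mem_filter] at h
    simp [Nat.add_sub_cancel' h.2.le]

theorem sum_filter_trichotomy {α : Type*} (s : Finset α) (a b : α → ℕ) (f : α → ℚ) :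
    ∑ x ∈ s, f x = ∑ x ∈ s with a x = b x, f x + ∑ x ∈ s with b x < a x, f x +
      ∑ x ∈ s with a x < b x, f x := by
  simp_rw [sum_filter, ← sum_add_distrib]
  refine sum_congr rfl fun x _ => ?_
  rcases lt_trichotomy (a x) (b x) with h | h | h
  · simp [h, h.ne, h.le]
  · simp [h]
  · simp [h, h.ne', h.le]

theorem add_pow_div_factorial (x y : ℚ) (m : ℕ) :
    (x + y) ^ m / m ! = ∑ i ∈ range (m + 1), (x ^ i / i !) * (y ^ (m - i) / (m - i)!) := by
  rw [add_pow, sum_div]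
  refine sum_congr rfl fun i hi => ?_
  rw [Nat.cast_choose ℚ (by simpa [Nat.lt_succ_iff] using hi)]
  have := Nat.factorial_ne_zero m
  field_simp

theorem sum_Ico_pow_div_factorial (V k : ℕ) (hk : 1 ≤ k) (hV : 1 ≤ V) :
    ∑ m ∈ Ico 1 V, (m : ℚ) ^ (k - 1) / (k - 1)! =
      (V : ℚ) ^ k / (k ! : ℚ) - 1 / 2 * ((V : ℚ) ^ (k - 1) / (k - 1)!) +
        ∑ j ∈ Icc 2 (k - 1),
          bernoulli (k - j + 1) / (k - j + 1)! * ((V : ℚ) ^ (j - 1) / (j - 1)!) -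
        if k = 1 then 1 / 2 else 0 := by
  obtain ⟨p, rfl⟩ := Nat.exists_eq_add_of_le' hk
  have faulhaber : ∑ m ∈ range V, (m : ℚ) ^ p / p ! =
      ∑ i ∈ range (p + 1), bernoulli i / i ! * ((V : ℚ) ^ (p + 1 - i) / (p + 1 - i)!) := by
    rw [← sum_div, sum_range_pow, sum_div]
    refine sum_congr rfl fun i hi => ?_
    rw [Nat.cast_choose ℚ (by simp at hi; omega), Nat.factorial_succ p]
    push_cast
    have := Nat.factorial_ne_zero p
    have : (p : ℚ) + 1 ≠ 0 := by positivity
    field_simp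
  rw [range_eq_Ico, sum_eq_sum_Ico_succ_bot (by omega)] at faulhaber
  rcases p with _ | p
  · simp at faulhaber ⊢
    linarith
  · rw [sum_range_succ', sum_range_succ'] at faulhaber
    have reindex : ∑ j ∈ Icc 2 (p + 1),
          bernoulli (p + 2 - j + 1) / (p + 2 - j + 1)! * ((V : ℚ) ^ (j - 1) / (j - 1)!) =
        ∑ i ∈ range p, bernoulli (i + 1 + 1) / (i + 1 + 1)! *
          ((V : ℚ) ^ (p + 1 + 1 - (i + 1 + 1)) / (p + 1 + 1 - (i + 1 + 1))!) := by
      refine sum_nbij' (fun j => p + 1 - j) (fun i => p + 1 - i) ?_ ?_ ?_ ?_ ?_ <;>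
        intro j hj <;> simp only [mem_Icc, mem_range] at hj ⊢ <;> try omega
      rw [show p + 2 - j + 1 = p + 1 - j + 1 + 1 by omega,
        show p + 1 + 1 - (p + 1 - j + 1 + 1) = j - 1 by omega]
    simp only [Nat.add_sub_cancel] at faulhaber ⊢
    rw [show p + 1 + 1 = p + 2 from rfl] at *
    rw [reindex]
    simp [bernoulli_one] at faulhaber ⊢
    linarith

theorem sum_coeff_biBracket_two (n k : ℕ) (hk : 1 ≤ k) :
    ∑ a ∈ Icc 1 k, PowerSeries.coeff n (biBracket 2 ![a, k + 1 - a] ![0, 0]) =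
      ∑ x ∈ divisorQuadruples n with x.2.2 < x.1.2, (x.1.2 : ℚ) ^ (k - 1) / (k - 1)! := by
  rw [sum_divisorQuadruples_snd_lt n fun v _ => (v : ℚ) ^ (k - 1) / (k - 1)!]
  simp_rw [coeff_biBracket_two]
  rw [sum_comm]
  refine sum_congr rfl fun x _ => ?_
  rw [Nat.cast_add, add_pow_div_factorial]
  refine sum_nbij' (fun a => a - 1) (fun i => i + 1) ?_ ?_ ?_ ?_ ?_ <;>
    intro a ha <;> simp only [mem_Icc, mem_range] at ha ⊢ <;> try omega
  rw [show k + 1 - a - 1 = k - 1 - (a - 1) by omega]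

theorem coeff_biBracket_two_one (n k : ℕ) :
    PowerSeries.coeff n (biBracket 2 ![k, 1] ![0, 0]) =
      ∑ x ∈ divisorQuadruples n with x.1.2 < x.2.2, (x.1.2 : ℚ) ^ (k - 1) / (k - 1)! := by
  rw [sum_divisorQuadruples_swap]
  refine Eq.trans ?_
    (sum_divisorQuadruples_snd_lt n fun _ v => (v : ℚ) ^ (k - 1) / (k - 1)!).symm
  simp [coeff_biBracket_two]

theorem biBracket_one_one_eq (k : ℕ) (hk : 1 ≤ k) :
    biBracket 1 ![k] ![1] =
      biBracket 1 ![k] ![0] * biBracket 1 ![1] ![0]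
        - (∑ a ∈ Icc 1 k, biBracket 2 ![a, k + 1 - a] ![0, 0])
        - biBracket 2 ![k, 1] ![0, 0] + biBracket 1 ![k] ![0] := by
  ext n
  simp only [map_sub, map_add, map_sum]
  rw [sum_coeff_biBracket_two n k hk, coeff_biBracket_two_one, coeff_biBracket_mul_biBracket_one,
    sum_filter_trichotomy _ (fun x => x.1.2) (fun x => x.2.2),
    sum_divisorQuadruples_snd_eq n fun v => (v : ℚ) ^ (k - 1) / (k - 1)!]
  simp only [coeff_biBracket_one, sub_mul, sum_sub_distrib]
  simp
  ring

theorem biBracket_mul_biBracket_one (k : ℕ) (hk : 1 ≤ k) :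
    biBracket 1 ![k] ![0] * biBracket 1 ![1] ![0] =
      biBracket 2 ![k, 1] ![0, 0] + biBracket 2 ![1, k] ![0, 0]
        + biBracket 1 ![k + 1] ![0] - (1 / 2 : ℚ) • biBracket 1 ![k] ![0]
        + (∑ j ∈ Icc 2 (k - 1),
            (bernoulli (k - j + 1) / ((k - j + 1)! : ℚ)) • biBracket 1 ![j] ![0])
        - (if k = 1 then (1 / 2 : ℚ) else 0) • biBracket 1 ![1] ![0] := by
  ext n
  rw [coeff_biBracket_mul_biBracket_one,
    sum_filter_trichotomy _ (fun x => x.1.1) (fun x => x.2.1),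
    sum_divisorQuadruples_fst_eq n fun _ v => (v : ℚ) ^ (k - 1) / (k - 1)!,
    sum_divisorQuadruples_swap n (fun x => x.1.1 < x.2.1)]
  have diagonal : ∑ p ∈ n.divisorsAntidiagonal, ∑ m ∈ Ico 1 p.2, (m : ℚ) ^ (k - 1) / (k - 1)! =
      ∑ p ∈ n.divisorsAntidiagonal, ((p.2 : ℚ) ^ k / (k ! : ℚ)
        - 1 / 2 * ((p.2 : ℚ) ^ (k - 1) / (k - 1)!) +
        ∑ j ∈ Icc 2 (k - 1),
          bernoulli (k - j + 1) / (k - j + 1)! * ((p.2 : ℚ) ^ (j - 1) / (j - 1)!) -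
        if k = 1 then 1 / 2 else 0) := by
    refine sum_congr rfl fun p hp => sum_Ico_pow_div_factorial p.2 k hk ?_
    exact Nat.pos_of_ne_zero (by rintro h; simp [h] at hp; omega)
  rw [diagonal, sum_sub_distrib, sum_add_distrib, sum_sub_distrib, sum_comm]
  split_ifs <;> simp [coeff_biBracket_one, coeff_biBracket_two, mul_sum] <;> ring

/-- Two expressions for `[k; 1]` in terms of brackets. -/
theorem biBracket_k_one (k : ℕ) (hk : 1 ≤ k) :
    (biBracket 1 ![k] ![1] =
      biBracket 1 ![k] ![0] * biBracket 1 ![1] ![0]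
        - (∑ a ∈ Finset.Icc 1 k, biBracket 2 ![a, k + 1 - a] ![0, 0])
        - biBracket 2 ![k, 1] ![0, 0] + biBracket 1 ![k] ![0]) ∧
    (biBracket 1 ![k] ![1] =
      biBracket 1 ![k + 1] ![0] + (1 / 2 : ℚ) • biBracket 1 ![k] ![0]
        - (∑ a ∈ Finset.Icc 2 k, biBracket 2 ![a, k + 1 - a] ![0, 0])
        + (∑ j ∈ Finset.Icc 2 (k - 1),
            (bernoulli (k - j + 1) / ((k - j + 1)! : ℚ)) • biBracket 1 ![j] ![0])
        - (if k = 1 then (1 / 2 : ℚ) else 0) • biBracket 1 ![1] ![0]) := by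
  refine ⟨biBracket_one_one_eq k hk, ?_⟩
  have split : ∑ a ∈ Icc 1 k, biBracket 2 ![a, k + 1 - a] ![0, 0] =
      biBracket 2 ![1, k] ![0, 0] + ∑ a ∈ Icc 2 k, biBracket 2 ![a, k + 1 - a] ![0, 0] := by
    rw [← Ioc_insert_left hk, sum_insert (by simp), Nat.add_sub_cancel]
    rfl
  have half : (1 / 2 : ℚ) • biBracket 1 ![k] ![0] + (1 / 2 : ℚ) • biBracket 1 ![k] ![0] =
      biBracket 1 ![k] ![0] := by
    rw [← add_smul]
    norm_num
  rw [biBracket_one_one_eq k hk, biBracket_mul_biBracket_one k hk, split]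
  linear_combination -half
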